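/- Let G=(V,w,m,d₀) be a salami with the combinatorial distance d₀ and connected salami partition P=(X,Y,K). Suppose there is ε > 0 such that w(x,y) ≥ ε for all adjacent x,y. Let f ∈ ℋ(P). Then for all x,y ∈ V: |f(x) - f(y)| ≤ d₀(x,y) ≤ |f(x) - f(y)| + C, where C = (2/ε) ∑_{x,y : f(y)<0 ≤ f(x)} w(x,y)(f(x)-f(y)). In particular, f is a quasi-isometric embedding of G into ℝ, so G is quasi-isometric to the line. -/

import Mathlib

open Filter

namespace SalamiPaper

variable {V : Type*}

/-- Locally finite: every vertex has finitely many neighbors. -/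
def LocallyFinite (w : V → V → ℝ) : Prop := ∀ x : V, {y | 0 < w x y}.Finite

/-- Connectedness of the weighted graph: any two vertices are joined by a path. -/
def GraphConnected (w : V → V → ℝ) : Prop :=
  ∀ x y : V, Relation.ReflTransGen (fun a b => 0 < w a b) x y

/-- The weighted graph Laplacian `Δf(x) = (1/m(x)) ∑_y w(x,y)(f(y)-f(x))`. -/
noncomputable def lap (w : V → V → ℝ) (m : V → ℝ) (f : V → ℝ) (x : V) : ℝ :=
  (m x)⁻¹ * ∑ᶠ y, w x y * (f y - f x)

/-- The vertex degree `Deg(x) = (1/m(x)) ∑_y w(x,y)`. -/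
noncomputable def deg (w : V → V → ℝ) (m : V → ℝ) (x : V) : ℝ :=
  (m x)⁻¹ * ∑ᶠ y, w x y

/-- The set of `d`-lengths of adjacency paths from `x` to `y`. -/
def pathLens (w : V → V → ℝ) (d : V → V → ℝ) (x y : V) : Set ℝ :=
  {L | ∃ (n : ℕ) (p : ℕ → V), p 0 = x ∧ p n = y ∧
    (∀ i < n, 0 < w (p i) (p (i + 1))) ∧
    L = ∑ i ∈ Finset.range n, d (p i) (p (i + 1))}

/-- `d` is a path metric on the graph with edge weight `w`. -/
def IsPathMetric (w : V → V → ℝ) (d : V → V → ℝ) : Prop :=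
  (∀ x, d x x = 0) ∧ (∀ x y, x ≠ y → 0 < d x y) ∧ (∀ x y, d x y = d y x) ∧
  (∀ x y z, d x z ≤ d x y + d y z) ∧
  (∀ x y, d x y = sInf (pathLens w d x y))

/-- All balls are finite. -/
def FiniteBalls (d : V → V → ℝ) : Prop := ∀ (x : V) (R : ℝ), {y | d x y ≤ R}.Finite

/-- The combinatorial graph distance (as a real number). -/
noncomputable def combDist (w : V → V → ℝ) (x y : V) : ℝ :=
  sInf {L | ∃ (n : ℕ) (p : ℕ → V), p 0 = x ∧ p n = y ∧
    (∀ i < n, 0 < w (p i) (p (i + 1))) ∧ L = (n : ℝ)}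

/-- `Lip(1)`: the 1-Lipschitz functions with respect to `d`. -/
def Lip1 (d : V → V → ℝ) (f : V → ℝ) : Prop := ∀ x y, f y - f x ≤ d x y

/-- The Ollivier curvature
`κ(x,y) = (1/d(x,y)) inf{Δf(x) - Δf(y) : f ∈ Lip(1), f(y)-f(x) = d(x,y)}`. -/
noncomputable def kappa (w : V → V → ℝ) (m : V → ℝ) (d : V → V → ℝ) (x y : V) : ℝ :=
  (d x y)⁻¹ * sInf {c | ∃ f : V → ℝ, Lip1 d f ∧ f y - f x = d x y ∧
    c = lap w m f x - lap w m f y}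

/-- `m(A) = ∞`: the total measure of `A` is infinite. -/
def InfVolume (m : V → ℝ) (A : Set V) : Prop :=
  ∀ c : ℝ, ∃ F : Finset V, ↑F ⊆ A ∧ c < ∑ x ∈ F, m x

/-- A salami partition `(X,Y,K)`. -/
def SalamiPartition (w : V → V → ℝ) (m : V → ℝ) (X Y K : Set V) : Prop :=
  X ∪ Y ∪ K = Set.univ ∧ Disjoint X Y ∧ Disjoint X K ∧ Disjoint Y K ∧
  K.Finite ∧ (∀ x ∈ X, ∀ y ∈ Y, w x y = 0) ∧ InfVolume m X ∧ InfVolume m Y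

/-- Reachability inside a subset `A` of the vertex set. -/
def reachIn (w : V → V → ℝ) (A : Set V) : V → V → Prop :=
  Relation.ReflTransGen (fun a b => a ∈ A ∧ b ∈ A ∧ 0 < w a b)

/-- The induced subgraph on `A` is connected. -/
def ConnectedIn (w : V → V → ℝ) (A : Set V) : Prop :=
  ∀ x ∈ A, ∀ y ∈ A, reachIn w A x y

/-- A connected salami partition: `K` induces a connected subgraph. -/
def ConnectedSalamiPartition (w : V → V → ℝ) (m : V → ℝ) (X Y K : Set V) : Prop :=
  SalamiPartition w m X Y K ∧ ConnectedIn w K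

/-- The basic standing assumptions on a weighted graph `G = (V,w,m,d)`:
countable vertex set, symmetric non-negative edge weight vanishing on the diagonal,
positive vertex measure, local finiteness, connectedness,
`d` a path metric with finite balls. -/
def IsGraphBase (w : V → V → ℝ) (m : V → ℝ) (d : V → V → ℝ) : Prop :=
  Countable V ∧ (∀ x y, w x y = w y x) ∧ (∀ x y, 0 ≤ w x y) ∧ (∀ x, w x x = 0) ∧
  (∀ x, 0 < m x) ∧ LocallyFinite w ∧ GraphConnected w ∧
  IsPathMetric w d ∧ FiniteBalls d

/-- Non-negative Ollivier curvature on all edges. -/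
def NonnegCurv (w : V → V → ℝ) (m : V → ℝ) (d : V → V → ℝ) : Prop :=
  ∀ x y, 0 < w x y → 0 ≤ kappa w m d x y

/-- A salami: a connected, locally finite weighted graph with a path metric with
finite balls, non-negative Ollivier curvature, admitting a salami partition. -/
def IsSalami (w : V → V → ℝ) (m : V → ℝ) (d : V → V → ℝ) : Prop :=
  IsGraphBase w m d ∧ NonnegCurv w m d ∧ ∃ X Y K : Set V, SalamiPartition w m X Y K

/-- `G` has at least `n` ends: there is a finite set `K` such that `V ∖ K` has at
least `n` infinite connected components. -/
def atLeastEnds (w : V → V → ℝ) (n : ℕ) : Prop :=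
  ∃ K : Set V, K.Finite ∧ ∃ x : Fin n → V,
    (∀ i, x i ∉ K) ∧ (∀ i, {y | reachIn w Kᶜ (x i) y}.Infinite) ∧
    (∀ i j, i ≠ j → ¬ reachIn w Kᶜ (x i) (x j))

/-- `Lip(1,K)`: functions that are 1-Lipschitz on `K`. -/
def Lip1On (d : V → V → ℝ) (K : Set V) (f : V → ℝ) : Prop :=
  ∀ x ∈ K, ∀ y ∈ K, f y - f x ≤ d x y

open Classical in
/-- The extremal Lipschitz extension operator `S(P)` of the salami partition
`P = (X,Y,K)`. -/
noncomputable def Sop (d : V → V → ℝ) (X Y K : Set V) (f : V → ℝ) : V → ℝ :=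
  fun v =>
    if v ∈ K then f v
    else if v ∈ X then sSup {c | ∃ u ∈ K, c = f u - d v u}
    else sInf {c | ∃ u ∈ K, c = f u + d v u}

/-- `ℱ(P) = S(P)(Lip(1,K))`. -/
def calF (d : V → V → ℝ) (X Y K : Set V) : Set (V → ℝ) :=
  {g | ∃ f : V → ℝ, Lip1On d K f ∧ g = Sop d X Y K f}

/-- `ℋ(P)`: the harmonic functions in `ℱ(P)`. -/
def calH (w : V → V → ℝ) (m : V → ℝ) (d : V → V → ℝ) (X Y K : Set V) :
    Set (V → ℝ) :=
  {g | g ∈ calF d X Y K ∧ ∀ x, lap w m g x = 0}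

/-- `∇₊f(x) = max_{y∼x} (f(y)-f(x))/d(x,y)`. -/
noncomputable def gradPlus (w : V → V → ℝ) (d : V → V → ℝ) (f : V → ℝ) (x : V) : ℝ :=
  sSup {c | ∃ y, 0 < w x y ∧ c = (f y - f x) / d x y}

/-- `∇₋f(x) = max_{y∼x} (f(x)-f(y))/d(x,y)`. -/
noncomputable def gradMinus (w : V → V → ℝ) (d : V → V → ℝ) (f : V → ℝ) (x : V) : ℝ :=
  sSup {c | ∃ y, 0 < w x y ∧ c = (f x - f y) / d x y}

/-- `|∇f|(x) = max_{y∼x} |f(y)-f(x)|/d(x,y)`. -/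
noncomputable def gradAbs (w : V → V → ℝ) (d : V → V → ℝ) (f : V → ℝ) (x : V) : ℝ :=
  sSup {c | ∃ y, 0 < w x y ∧ c = |f y - f x| / d x y}

/-- Recurrence: for every `ε > 0` there is a finitely supported `f` with
`‖f‖∞ = 1` and `-⟨f, Δf⟩ < ε`. -/
def Recurrent (w : V → V → ℝ) (m : V → ℝ) : Prop :=
  ∀ ε : ℝ, 0 < ε → ∃ f : V → ℝ, (Function.support f).Finite ∧
    (∀ x, |f x| ≤ 1) ∧ (∃ x, |f x| = 1) ∧
    -(∑ᶠ x, f x * lap w m f x * m x) < ε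

open Classical in
/-- `∑_{x,y : f(y) < 0 ≤ f(x)} w(x,y)(f(x)-f(y))`. -/
noncomputable def cutSum (w : V → V → ℝ) (f : V → ℝ) : ℝ :=
  ∑ᶠ p : V × V, if f p.2 < 0 ∧ 0 ≤ f p.1 then w p.1 p.2 * (f p.1 - f p.2) else 0

/-- Subexponential growth: `max_{B_r(x)} |u| = e^{o(r)}` as `r → ∞`. -/
def SubexpGrowth (d : V → V → ℝ) (x : V) (u : V → ℝ) : Prop :=
  Filter.Tendsto
    (fun r : ℕ => Real.log (sSup {c | ∃ y, d x y ≤ (r : ℝ) ∧ c = |u y|}) / (r : ℝ))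
    Filter.atTop (nhds 0)


/-- The simple graph underlying a weighted graph. -/
def adjGraph (w : V → V → ℝ) (hsymm : ∀ x y, w x y = w y x) (hdiag : ∀ x, w x x = 0) :
    SimpleGraph V where
  Adj x y := 0 < w x y
  symm := ⟨fun x y h => by rwa [hsymm y x]⟩
  loopless := ⟨fun x h => by simp [hdiag] at h⟩

lemma adjGraph_connected {w : V → V → ℝ} (hsymm : ∀ x y, w x y = w y x)
    (hdiag : ∀ x, w x x = 0) [Nonempty V] (hconn : GraphConnected w) :
    (adjGraph w hsymm hdiag).Connected := by
  refine ⟨fun x y => ?_⟩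
  induction hconn x y with
  | refl => exact SimpleGraph.Reachable.refl _
  | tail _ h ih => exact ih.trans (SimpleGraph.Adj.reachable (G := adjGraph w hsymm hdiag) h)

lemma combDist_eq_dist {w : V → V → ℝ} (hsymm : ∀ x y, w x y = w y x)
    (hdiag : ∀ x, w x x = 0) (hG : (adjGraph w hsymm hdiag).Connected) (x y : V) :
    combDist w x y = ((adjGraph w hsymm hdiag).dist x y : ℝ) := by
  refine IsLeast.csInf_eq ⟨?_, ?_⟩
  · obtain ⟨p, hp⟩ := hG.exists_walk_length_eq_dist x y
    refine ⟨p.length, p.getVert, by simp, by simp, fun i hi => ?_, by rw [hp]⟩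
    exact p.adj_getVert_succ hi
  · rintro _ ⟨n, p, rfl, rfl, hadj, rfl⟩
    have key : ∀ k ≤ n, ∃ q : (adjGraph w hsymm hdiag).Walk (p 0) (p k), q.length = k := by
      intro k
      induction k with
      | zero => exact fun _ => ⟨.nil, rfl⟩
      | succ k ih =>
        intro hk
        obtain ⟨q, hq⟩ := ih (by omega)
        have h : (adjGraph w hsymm hdiag).Adj (p k) (p (k + 1)) := hadj k (by omega)
        exact ⟨q.concat h, by simp [hq]⟩
    obtain ⟨q, hq⟩ := key n le_rfl
    exact_mod_cast hq ▸ SimpleGraph.dist_le q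

section Order

variable {G : SimpleGraph V} {f : V → ℝ}

lemma exists_dist_eq_of_le_dist (hG : G.Connected) {x y : V} {k : ℕ} (hk : k ≤ G.dist x y) :
    ∃ z, G.dist x z = k ∧ k + G.dist z y = G.dist x y := by
  obtain ⟨p, hp⟩ := hG.exists_walk_length_eq_dist x y
  refine ⟨p.getVert k, ?_⟩
  have h1 := SimpleGraph.dist_le (p.take k)
  have h2 := SimpleGraph.dist_le (p.drop k)
  have h3 := hG.dist_triangle (u := x) (v := p.getVert k) (w := y)
  simp only [SimpleGraph.Walk.take_length, SimpleGraph.Walk.drop_length] at h1 h2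
  omega

/-- `f` realises the graph distance from `x` up to `y`. -/
def Below (G : SimpleGraph V) (f : V → ℝ) (x y : V) : Prop := f y - f x = G.dist x y

lemma Below.refl (x : V) : Below G f x x := by simp [Below]

lemma Below.le {x y : V} (h : Below G f x y) : f x ≤ f y := by
  have : (0 : ℝ) ≤ G.dist x y := Nat.cast_nonneg _
  unfold Below at h
  linarith

lemma below_neg {x y : V} : Below G (-f) y x ↔ Below G f x y := by
  simp only [Below, Pi.neg_apply, G.dist_comm (u := y)]
  rw [neg_sub_neg]

lemma cast_dist_triangle (hG : G.Connected) (x y z : V) :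
    (G.dist x z : ℝ) ≤ G.dist x y + G.dist y z := by
  exact_mod_cast hG.dist_triangle

lemma Below.trans (hG : G.Connected) (hf : ∀ x y, f y - f x ≤ G.dist x y) {x y z : V}
    (hxy : Below G f x y) (hyz : Below G f y z) : Below G f x z := by
  have h1 := hf x z
  have h2 := cast_dist_triangle hG x y z
  unfold Below at *
  linarith

lemma Below.exists_between (hG : G.Connected) (hf : ∀ x y, f y - f x ≤ G.dist x y) {x y : V}
    (hxy : Below G f x y) {k : ℕ} (hk : k ≤ G.dist x y) :
    ∃ z, G.dist x z = k ∧ k + G.dist z y = G.dist x y ∧ Below G f x z ∧ Below G f z y := by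
  obtain ⟨z, hz, hzy⟩ := exists_dist_eq_of_le_dist hG hk
  have h1 := hf x z
  have h2 := hf z y
  have h3 : (k : ℝ) + G.dist z y = G.dist x y := by exact_mod_cast hzy
  refine ⟨z, hz, hzy, ?_, ?_⟩ <;> unfold Below at * <;> rw [hz] at * <;> linarith

lemma Below.eq_of_le (hG : G.Connected) {x y : V} (h : Below G f x y) (hle : f y ≤ f x) :
    x = y := by
  refine hG.dist_eq_zero_iff.1 ?_
  unfold Below at h
  have : (G.dist x y : ℝ) ≤ 0 := by linarith
  exact_mod_cast le_antisymm this (Nat.cast_nonneg _)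

/-- Neighbours of `x` are carried above into the unit ball of any `y` above `x`. -/
def LiftsUp (G : SimpleGraph V) (f : V → ℝ) : Prop :=
  ∀ x y x', Below G f x y → G.Adj x x' → ∃ y', G.dist y y' ≤ 1 ∧ Below G f x' y'

lemma LiftsUp.exists_of_neg (h : LiftsUp G (-f)) {x y y' : V} (hxy : Below G f x y)
    (hy : G.Adj y y') : ∃ x', G.dist x x' ≤ 1 ∧ Below G f x' y' := by
  obtain ⟨x', hx, hb⟩ := h y x y' (below_neg.2 hxy) hy
  exact ⟨x', hx, below_neg.1 hb⟩

lemma LiftsUp.exists_dist_le (hG : G.Connected) (h : LiftsUp G f) {x y : V}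
    (hxy : Below G f x y) (x' : V) :
    ∃ y', G.dist y y' ≤ G.dist x x' ∧ Below G f x' y' := by
  induction hn : G.dist x x' generalizing x' with
  | zero =>
    obtain rfl := hG.dist_eq_zero_iff.1 hn
    exact ⟨y, by simp, hxy⟩
  | succ n ih =>
    obtain ⟨z, hz, hzx⟩ := exists_dist_eq_of_le_dist hG (x := x) (y := x') (k := n) (by omega)
    obtain ⟨y', hy', hb⟩ := ih z hz
    obtain ⟨y'', hy'', hb'⟩ := h z y' x' hb (SimpleGraph.dist_eq_one_iff_adj.1 (by omega))
    have := hG.dist_triangle (u := y) (v := y') (w := y'')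
    exact ⟨y'', by omega, hb'⟩

lemma LiftsUp.exists_above_gt (hG : G.Connected) (hf : ∀ x y, f y - f x ≤ G.dist x y)
    (h : LiftsUp G f) {K : Set V} (hK : K.Finite)
    (hunb : ∀ M : ℝ, ∃ u ∈ K, ∃ c, Below G f u c ∧ M < f c) (v : V) (M : ℝ) :
    ∃ c, Below G f v c ∧ M < f c := by
  obtain ⟨D, hD⟩ := (hK.image fun u => (G.dist u v : ℝ)).bddAbove
  obtain ⟨u, hu, c, huc, hc⟩ := hunb (M + D)
  obtain ⟨c', hd, hb⟩ := h.exists_dist_le hG huc v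
  refine ⟨c', hb, ?_⟩
  have h1 : (G.dist u v : ℝ) ≤ D := hD ⟨u, hu, rfl⟩
  have h2 : (G.dist c c' : ℝ) ≤ G.dist u v := by exact_mod_cast hd
  have h3 := hf c' c
  rw [G.dist_comm] at h3
  linarith

lemma exists_above_dist_eq (hG : G.Connected) (hf : ∀ x y, f y - f x ≤ G.dist x y)
    (hup : ∀ v M, ∃ c, Below G f v c ∧ M < f c) (v : V) (k : ℕ) :
    ∃ c, Below G f v c ∧ G.dist v c = k := by
  obtain ⟨c, hb, hc⟩ := hup v (f v + k)
  have hk : k ≤ G.dist v c := by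
    have : (k : ℝ) ≤ G.dist v c := by unfold Below at hb; linarith
    exact_mod_cast this
  obtain ⟨z, hz, -, hvz, -⟩ := hb.exists_between hG hf hk
  exact ⟨z, hvz, hz⟩

/-- The vertices where `f` takes values in `[r, r + 1)`. -/
def slab (f : V → ℝ) (r : ℝ) : Set V := {v | r ≤ f v ∧ f v < r + 1}

/-- Two points of a slab at distance at most two. -/
def SlabStep (G : SimpleGraph V) (f : V → ℝ) (r : ℝ) (a b : V) : Prop :=
  a ∈ slab f r ∧ b ∈ slab f r ∧ G.dist a b ≤ 2

lemma exists_slabStep (hG : G.Connected) (hf : ∀ x y, f y - f x ≤ G.dist x y)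
    (hlift : LiftsUp G f) (hup : ∀ v M, ∃ c, Below G f v c ∧ M < f c) {r : ℝ} {v v' a : V}
    (hva : Below G f v a) (ha : a ∈ slab f r) (hv : G.dist v v' ≤ 1) (hr : f v' < r + 1) :
    ∃ b, SlabStep G f r a b ∧ Below G f v' b := by
  obtain ⟨b, hab, hb⟩ := hlift.exists_dist_le hG hva v'
  have hab' : (G.dist a b : ℝ) ≤ 1 := by exact_mod_cast hab.trans hv
  have h1 := hf a b
  have h2 := hf b a
  rw [G.dist_comm] at h2
  have ha1 := ha.1
  have ha2 := ha.2
  rcases lt_or_ge (f b) r with hlt | hge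
  · obtain ⟨c, hbc, hc⟩ := exists_above_dist_eq hG hf hup b 1
    have h3 := hbc
    unfold Below at h3
    rw [hc, Nat.cast_one] at h3
    have := hG.dist_triangle (u := a) (v := b) (w := c)
    exact ⟨c, ⟨ha, ⟨by linarith, by linarith⟩, by omega⟩, hb.trans hG hf hbc⟩
  · rcases lt_or_ge (f b) (r + 1) with hlt | hge'
    · exact ⟨b, ⟨ha, ⟨hge, hlt⟩, by omega⟩, hb⟩
    · have hpos : 0 < G.dist v' b := by
        rw [Nat.pos_iff_ne_zero]
        intro h0
        obtain rfl := hG.dist_eq_zero_iff.1 h0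
        linarith
      obtain ⟨c, -, hcb, hvc, hcb'⟩ := hb.exists_between hG hf (k := G.dist v' b - 1) (by omega)
      have hd : G.dist c b = 1 := by omega
      unfold Below at hcb'
      rw [hd, Nat.cast_one] at hcb'
      have := hG.dist_triangle (u := a) (v := b) (w := c)
      rw [G.dist_comm (u := b), hd] at this
      exact ⟨c, ⟨ha, ⟨by linarith, by linarith⟩, by omega⟩, hvc⟩

lemma slabStep_reflTransGen_of_below (hG : G.Connected) (hf : ∀ x y, f y - f x ≤ G.dist x y)
    (hlift : LiftsUp G f) (hup : ∀ v M, ∃ c, Below G f v c ∧ M < f c) {r : ℝ} {v a b : V}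
    (hva : Below G f v a) (hvb : Below G f v b) (ha : a ∈ slab f r) (hb : b ∈ slab f r) :
    Relation.ReflTransGen (SlabStep G f r) a b := by
  have hb2 := hb.2
  induction hn : G.dist v b generalizing v a with
  | zero =>
    obtain rfl := hG.dist_eq_zero_iff.1 hn
    have hlt : G.dist v a < 1 := by
      have h1 := hb.1
      have h2 := ha.2
      have : (G.dist v a : ℝ) < 1 := by unfold Below at hva; linarith
      exact_mod_cast this
    obtain rfl := hG.dist_eq_zero_iff.1 (Nat.lt_one_iff.1 hlt)
    exact .refl
  | succ n ih =>
    obtain ⟨c, hvc, hcb, -, hcb'⟩ := hvb.exists_between hG hf (k := 1) (by omega)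
    obtain ⟨a', haa', hca'⟩ := exists_slabStep hG hf hlift hup hva ha hvc.le
      (hcb'.le.trans_lt hb2)
    exact .head haa' (ih hca' hcb' haa'.2.1 (by omega))

lemma slabStep_reflTransGen (hG : G.Connected) (hf : ∀ x y, f y - f x ≤ G.dist x y)
    (hlift : LiftsUp G f) (hlift' : LiftsUp G (-f))
    (hup : ∀ v M, ∃ c, Below G f v c ∧ M < f c) (hdown : ∀ v M, ∃ c, Below G f c v ∧ f c < M)
    {r : ℝ} {a b : V} (ha : a ∈ slab f r) (hb : b ∈ slab f r) :
    Relation.ReflTransGen (SlabStep G f r) a b := by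
  have key : ∀ (n : ℕ) (y : V), G.dist a y = n → ∀ c, Below G f c a → f c + n < r + 1 →
      ∃ c' a', Below G f c' y ∧ Below G f c' a' ∧ a' ∈ slab f r ∧ f c' ≤ f c + n ∧
        Relation.ReflTransGen (SlabStep G f r) a a' := by
    intro n
    induction n with
    | zero =>
      intro y hy c hc _
      obtain rfl := hG.dist_eq_zero_iff.1 hy
      exact ⟨c, a, hc, hc, ha, by simp, .refl⟩
    | succ n ih =>
      intro y hy c hc hlow
      push_cast at hlow
      obtain ⟨z, hz, hzy⟩ := exists_dist_eq_of_le_dist hG (x := a) (y := y) (k := n) (by omega)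
      obtain ⟨c₁, a₁, h1, h2, h3, h4, h5⟩ := ih z hz c hc (by linarith)
      obtain ⟨c₂, hc₂, hb₂⟩ := hlift'.exists_of_neg h1
        (SimpleGraph.dist_eq_one_iff_adj.1 (show G.dist z y = 1 by omega))
      have h6 := hf c₁ c₂
      have h7 : (G.dist c₁ c₂ : ℝ) ≤ 1 := by exact_mod_cast hc₂
      obtain ⟨a₂, hstep, hb₃⟩ := exists_slabStep hG hf hlift hup h2 h3 hc₂ (by linarith)
      exact ⟨c₂, a₂, hb₂, hb₃, hstep.2.1, by push_cast; linarith, h5.tail hstep⟩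
  obtain ⟨c, hc, hlow⟩ := hdown a (r + 1 - G.dist a b)
  obtain ⟨c', a', h1, h2, h3, -, h5⟩ := key _ b rfl c hc (by linarith)
  exact h5.trans (slabStep_reflTransGen_of_below hG hf hlift hup h2 h1 h3 hb)

lemma dist_le_of_slabStep_reflTransGen (hG : G.Connected) {r : ℝ} {S : Finset V}
    (hS : ∀ v, v ∈ S ↔ v ∈ slab f r) {a b : V} (ha : a ∈ S)
    (h : Relation.ReflTransGen (SlabStep G f r) a b) :
    G.dist a b ≤ 2 * S.card := by
  classical
  let H : SimpleGraph S := SimpleGraph.fromRel fun u v => G.dist (u : V) v ≤ 2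
  have hreach : ∃ hb : b ∈ S, H.Reachable ⟨a, ha⟩ ⟨b, hb⟩ := by
    induction h with
    | refl => exact ⟨ha, .refl _⟩
    | @tail c d _ hcd ih =>
      obtain ⟨hc, hr⟩ := ih
      have hd := (hS d).2 hcd.2.1
      refine ⟨hd, hr.trans ?_⟩
      by_cases heq : c = d
      · subst heq
        exact .refl _
      · exact SimpleGraph.Adj.reachable
          ((SimpleGraph.fromRel_adj _ _ _).2 ⟨by simpa using heq, .inl hcd.2.2⟩)
  obtain ⟨hb, ⟨p⟩⟩ := hreach
  have hlen : ∀ {u v : S} (q : H.Walk u v), G.dist (u : V) v ≤ 2 * q.length := by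
    intro u v q
    induction q with
    | nil => simp
    | @cons u v t hadj q ih =>
      have h1 : G.dist (u : V) v ≤ 2 := by
        rcases ((SimpleGraph.fromRel_adj _ _ _).1 hadj).2 with h | h
        · exact h
        · rwa [G.dist_comm]
      have h2 := hG.dist_triangle (u := (u : V)) (v := v) (w := t)
      rw [SimpleGraph.Walk.length_cons]
      omega
  have h1 := hlen p.bypass
  have h2 := p.bypass_isPath.length_lt
  rw [Fintype.card_coe] at h2
  exact h1.trans (by omega)

end Order

section Curvature

variable {w : V → V → ℝ} {m : V → ℝ}

lemma lap_eq_sum (hnn : ∀ x y, 0 ≤ w x y) (hLF : LocallyFinite w) (g : V → ℝ) (x : V) :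
    lap w m g x = (m x)⁻¹ * ∑ z ∈ (hLF x).toFinset, w x z * (g z - g x) := by
  unfold lap
  rw [finsum_eq_sum_of_support_subset]
  intro z hz
  have : w x z ≠ 0 := left_ne_zero_of_mul hz
  simpa using lt_of_le_of_ne (hnn x z) this.symm

lemma lap_neg (g : V → ℝ) (x : V) : lap w m (-g) x = -lap w m g x := by
  simp only [lap, Pi.neg_apply]
  rw [← mul_neg, ← finsum_neg_distrib]
  congr 2
  ext y
  ring

lemma abs_lap_le {d : V → V → ℝ} (hnn : ∀ x y, 0 ≤ w x y) (hm : ∀ x, 0 < m x)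
    (hLF : LocallyFinite w) (hd : ∀ x y, 0 < w x y → d x y = 1 ∧ d y x = 1) {g : V → ℝ}
    (hg : Lip1 d g) (x : V) :
    |lap w m g x| ≤ (m x)⁻¹ * ∑ z ∈ (hLF x).toFinset, w x z := by
  have hm' : 0 ≤ (m x)⁻¹ := (inv_pos.2 (hm x)).le
  rw [lap_eq_sum hnn hLF, abs_mul, abs_of_nonneg hm']
  refine mul_le_mul_of_nonneg_left ((Finset.abs_sum_le_sum_abs _ _).trans ?_) hm'
  refine Finset.sum_le_sum fun z hz => ?_
  have hz' : 0 < w x z := by simpa using hz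
  rw [abs_mul, abs_of_pos hz']
  have h1 := hg x z
  have h2 := hg z x
  rw [(hd x z hz').1] at h1
  rw [(hd x z hz').2] at h2
  exact mul_le_of_le_one_right hz'.le (abs_le.2 ⟨by linarith, h1⟩)

lemma lap_le_lap_of_adj {d : V → V → ℝ} (hnn : ∀ x y, 0 ≤ w x y) (hm : ∀ x, 0 < m x)
    (hLF : LocallyFinite w) (hd : ∀ x y, 0 < w x y → d x y = 1 ∧ d y x = 1)
    (hcurv : NonnegCurv w m d) {g : V → ℝ} (hg : Lip1 d g) {x y : V} (hxy : 0 < w x y)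
    (h : g y - g x = 1) : lap w m g y ≤ lap w m g x := by
  have hk := hcurv x y hxy
  have hd1 := (hd x y hxy).1
  rw [kappa, hd1, inv_one, one_mul] at hk
  rw [← sub_nonneg]
  refine hk.trans (csInf_le ⟨-((m x)⁻¹ * ∑ z ∈ (hLF x).toFinset, w x z) -
    (m y)⁻¹ * ∑ z ∈ (hLF y).toFinset, w y z, ?_⟩ ⟨g, hg, h, rfl⟩)
  rintro _ ⟨u, hu, -, rfl⟩
  have h1 := (abs_le.1 (abs_lap_le hnn hm hLF hd hu x)).1
  have h2 := (abs_le.1 (abs_lap_le hnn hm hLF hd hu y)).2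
  linarith

variable {G : SimpleGraph V}

lemma lap_le_lap_of_below (hG : G.Connected)
    (hcurv : ∀ g : V → ℝ, (∀ x y, g y - g x ≤ G.dist x y) → ∀ x y, G.Adj x y →
      g y - g x = 1 → lap w m g y ≤ lap w m g x)
    {g : V → ℝ} (hg : ∀ x y, g y - g x ≤ G.dist x y) {x y : V} (h : Below G g x y) :
    lap w m g y ≤ lap w m g x := by
  induction hn : G.dist x y generalizing x with
  | zero =>
    obtain rfl := hG.dist_eq_zero_iff.1 hn
    exact le_rfl
  | succ n ih =>
    obtain ⟨z, hxz, hzy, hb, hb'⟩ := h.exists_between hG hg (k := 1) (by omega)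
    refine (ih hb' (by omega)).trans (hcurv g hg x z (SimpleGraph.dist_eq_one_iff_adj.1 hxz) ?_)
    unfold Below at hb
    rw [hb, hxz, Nat.cast_one]

lemma liftsUp_of_lap_eq_zero (hG : G.Connected) (hadj : ∀ x y, G.Adj x y ↔ 0 < w x y)
    (hnn : ∀ x y, 0 ≤ w x y) (hm : ∀ x, 0 < m x) (hLF : LocallyFinite w)
    (hcurv : ∀ g : V → ℝ, (∀ x y, g y - g x ≤ G.dist x y) → ∀ x y, G.Adj x y →
      g y - g x = 1 → lap w m g y ≤ lap w m g x)
    {f : V → ℝ} (hf : ∀ x y, f y - f x ≤ G.dist x y) (hharm : ∀ x, lap w m f x = 0) :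
    LiftsUp G f := by
  classical
  intro x y x' hxy hx'
  by_contra! hcon
  have hx'd : G.dist x x' = 1 := SimpleGraph.dist_eq_one_iff_adj.2 hx'
  have hstrict : ∀ v, ¬ Below G f x' v → 0 < f x' + G.dist x' v - f v := by
    intro v hv
    have := lt_of_le_of_ne (hf x' v) hv
    linarith
  have hx : ¬ Below G f x' x := by
    intro hb
    exact hcon y (by simp) (hb.trans hG hf hxy)
  -- the vertices on which the perturbed function must agree with `f`
  let T : Finset V := insert x (insert y (hLF y).toFinset)
  have hT : ∀ v ∈ T, 0 < f x' + G.dist x' v - f v := by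
    intro v hv
    refine hstrict v ?_
    simp only [T, Finset.mem_insert, Set.Finite.mem_toFinset, Set.mem_ofPred_eq] at hv
    rcases hv with rfl | rfl | hv
    · exact hx
    · exact hcon v (by simp)
    · exact hcon v (SimpleGraph.dist_eq_one_iff_adj.2 ((hadj y v).2 hv)).le
  obtain ⟨v₀, hv₀, hmin⟩ := T.exists_min_image (fun v => f x' + G.dist x' v - f v)
    ⟨x, Finset.mem_insert_self _ _⟩
  set δ := f x' + G.dist x' v₀ - f v₀ with hδ
  have hδpos : 0 < δ := hT v₀ hv₀
  let g : V → ℝ := fun v => min (f v) (f x' - δ + G.dist x' v)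
  have hgle : ∀ v, g v ≤ f v := fun v => min_le_left _ _
  have hgT : ∀ v ∈ T, g v = f v := by
    intro v hv
    refine min_eq_left ?_
    have := hmin v hv
    linarith
  have hgx' : g x' < f x' := by
    refine (min_le_right _ _).trans_lt ?_
    simpa using hδpos
  have hg : ∀ a b, g b - g a ≤ G.dist a b := by
    intro a b
    rw [sub_le_iff_le_add]
    rcases min_choice (f a) (f x' - δ + G.dist x' a) with h | h
    · have h1 := hf a b
      have h2 := hgle b
      simp only [g] at *
      rw [h]
      linarith
    · have h1 := cast_dist_triangle hG x' a b
      have h2 : g b ≤ _ := min_le_right _ _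
      simp only [g] at *
      rw [h]
      linarith
  have hgx : g x = f x := hgT x (by simp [T])
  have hgy : g y = f y := hgT y (by simp [T])
  have hle := lap_le_lap_of_below hG hcurv hg (x := x) (y := y)
    (by unfold Below at *; rw [hgx, hgy, hxy])
  have hy0 : lap w m g y = 0 := by
    rw [← hharm y, lap_eq_sum hnn hLF, lap_eq_sum hnn hLF, hgy]
    congr 1
    refine Finset.sum_congr rfl fun z hz => ?_
    rw [hgT z (Finset.mem_insert_of_mem (Finset.mem_insert_of_mem hz))]
  have hx0 : lap w m g x < 0 := by
    rw [← hharm x, lap_eq_sum hnn hLF, lap_eq_sum hnn hLF, hgx]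
    refine mul_lt_mul_of_pos_left (Finset.sum_lt_sum (fun z _ => ?_) ⟨x', ?_, ?_⟩)
      (inv_pos.2 (hm x))
    · exact mul_le_mul_of_nonneg_left (by linarith [hgle z]) (hnn x z)
    · simpa using (hadj x x').1 hx'
    · exact mul_lt_mul_of_pos_left (by linarith) ((hadj x x').1 hx')
  linarith

end Curvature

section Partition

variable {w : V → V → ℝ} {m : V → ℝ} {G : SimpleGraph V} {X Y K : Set V}

lemma InfVolume.infinite (hm : ∀ x, 0 < m x) {A : Set V} (hA : InfVolume m A) : A.Infinite := by
  intro hfin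
  obtain ⟨F, hF, hlt⟩ := hA (∑ x ∈ hfin.toFinset, m x)
  refine hlt.not_ge (Finset.sum_le_sum_of_subset_of_nonneg ?_ fun x _ _ => (hm x).le)
  intro x hx
  simpa using hF hx

lemma exists_mem_separator (hG : G.Connected) (hadj : ∀ x y, G.Adj x y ↔ 0 < w x y)
    (hcov : X ∪ Y ∪ K = Set.univ) (hdisj : Disjoint X Y) (hsep : ∀ x ∈ X, ∀ y ∈ Y, w x y = 0)
    {x y : V} (hx : x ∈ X) (hy : y ∈ Y) :
    ∃ u ∈ K, G.dist x u + G.dist u y = G.dist x y := by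
  induction hn : G.dist x y generalizing x with
  | zero =>
    obtain rfl := hG.dist_eq_zero_iff.1 hn
    exact absurd hy (Set.disjoint_left.1 hdisj hx)
  | succ n ih =>
    obtain ⟨z, hxz, hzy⟩ := exists_dist_eq_of_le_dist hG (x := x) (y := y) (k := 1) (by omega)
    have hw := (hadj x z).1 (SimpleGraph.dist_eq_one_iff_adj.1 hxz)
    rcases (hcov.symm ▸ Set.mem_univ z : z ∈ X ∪ Y ∪ K) with (hz | hz) | hz
    · obtain ⟨u, hu, hd⟩ := ih hz (by omega)
      have h1 := hG.dist_triangle (u := x) (v := z) (w := u)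
      have h2 := hG.dist_triangle (u := x) (v := u) (w := y)
      exact ⟨u, hu, by omega⟩
    · exact absurd (hsep x hx z hz) hw.ne'
    · exact ⟨z, hz, by omega⟩

lemma calF_spec {d : V → V → ℝ} (hXY : Disjoint X Y) (hXK : Disjoint X K) (hYK : Disjoint Y K)
    (hK : K.Finite) (hne : K.Nonempty) {f : V → ℝ} (hf : f ∈ calF d X Y K) :
    (∀ u ∈ K, ∀ v ∈ K, f v - f u ≤ d u v) ∧
    (∀ v ∈ X, (∃ u ∈ K, f v = f u - d v u) ∧ ∀ u ∈ K, f u - d v u ≤ f v) ∧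
    (∀ v ∈ Y, (∃ u ∈ K, f v = f u + d v u) ∧ ∀ u ∈ K, f v ≤ f u + d v u) := by
  obtain ⟨F, hF, rfl⟩ := hf
  have hSK : ∀ u ∈ K, Sop d X Y K F u = F u := fun u hu => by simp [Sop, hu]
  have himg : ∀ h : V → ℝ, {c | ∃ u ∈ K, c = h u} = h '' K := by
    intro h
    ext c
    simp [eq_comm]
  refine ⟨fun u hu v hv => ?_, fun v hv => ?_, fun v hv => ?_⟩
  · rw [hSK u hu, hSK v hv]
    exact hF u hu v hv
  · have hval : Sop d X Y K F v = sSup ((fun u => F u - d v u) '' K) := by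
      simp [Sop, Set.disjoint_left.1 hXK hv, hv, himg]
    have hfin : ((fun u => F u - d v u) '' K).Finite := hK.image _
    rw [hval]
    constructor
    · obtain ⟨u, hu, he⟩ := (hne.image _).csSup_mem hfin
      exact ⟨u, hu, by rw [hSK u hu, ← he]⟩
    · intro u hu
      rw [hSK u hu]
      exact le_csSup hfin.bddAbove ⟨u, hu, rfl⟩
  · have hval : Sop d X Y K F v = sInf ((fun u => F u + d v u) '' K) := by
      simp [Sop, Set.disjoint_left.1 hYK hv, Set.disjoint_right.1 hXY hv, himg]
    have hfin : ((fun u => F u + d v u) '' K).Finite := hK.image _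
    rw [hval]
    constructor
    · obtain ⟨u, hu, he⟩ := (hne.image _).csInf_mem hfin
      exact ⟨u, hu, by rw [hSK u hu, ← he]⟩
    · intro u hu
      rw [hSK u hu]
      exact csInf_le hfin.bddBelow ⟨u, hu, rfl⟩

lemma extension_lipschitz (hG : G.Connected) (hcov : X ∪ Y ∪ K = Set.univ)
    (hcross : ∀ x ∈ X, ∀ y ∈ Y, ∃ u ∈ K, G.dist x u + G.dist u y = G.dist x y) {f : V → ℝ}
    (hKK : ∀ u ∈ K, ∀ v ∈ K, f v - f u ≤ G.dist u v)
    (hX : ∀ v ∈ X, (∃ u ∈ K, f v = f u - G.dist v u) ∧ ∀ u ∈ K, f u - G.dist v u ≤ f v)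
    (hY : ∀ v ∈ Y, (∃ u ∈ K, f v = f u + G.dist v u) ∧ ∀ u ∈ K, f v ≤ f u + G.dist v u)
    (a b : V) : f b - f a ≤ G.dist a b := by
  have htri := cast_dist_triangle hG
  have hcomm : ∀ u v, (G.dist u v : ℝ) = G.dist v u := fun u v => by rw [G.dist_comm]
  have hmem : ∀ v, v ∈ X ∪ Y ∪ K := fun v => hcov.symm ▸ Set.mem_univ v
  have hto : ∀ u ∈ K, ∀ a, f u - f a ≤ G.dist a u := by
    intro u hu a
    rcases hmem a with (ha | ha) | ha
    · linarith [(hX a ha).2 u hu]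
    · obtain ⟨u', hu', he⟩ := (hY a ha).1
      linarith [hKK u' hu' u hu, htri u' a u, hcomm u' a]
    · exact hKK a ha u hu
  rcases hmem b with (hb | hb) | hb
  · obtain ⟨u, hu, he⟩ := (hX b hb).1
    linarith [hto u hu a, htri a b u]
  · rcases hmem a with (ha | ha) | ha
    · obtain ⟨u, hu, hd⟩ := hcross a ha b hb
      have hd' : (G.dist a u : ℝ) + G.dist u b = G.dist a b := by exact_mod_cast hd
      linarith [(hX a ha).2 u hu, (hY b hb).2 u hu, hcomm u b]
    · obtain ⟨u, hu, he⟩ := (hY a ha).1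
      linarith [(hY b hb).2 u hu, htri b a u, hcomm a b]
    · linarith [(hY b hb).2 a ha, hcomm a b]
  · exact hto b hb a

lemma finite_setOf_dist_le (hK : K.Finite)
    (hball : ∀ (x : V) (R : ℝ), {y | (G.dist x y : ℝ) ≤ R}.Finite)
    (R : V → ℝ) : {v | ∃ u ∈ K, (G.dist v u : ℝ) ≤ R u}.Finite := by
  refine (hK.biUnion fun u _ => hball u (R u)).subset ?_
  rintro v ⟨u, hu, hd⟩
  rw [G.dist_comm] at hd
  exact Set.mem_biUnion hu hd

lemma exists_below_lt_of_infinite (hK : K.Finite)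
    (hball : ∀ (x : V) (R : ℝ), {y | (G.dist x y : ℝ) ≤ R}.Finite) {f : V → ℝ}
    (hXinf : X.Infinite) (hX : ∀ v ∈ X, ∃ u ∈ K, f v = f u - G.dist v u) (M : ℝ) :
    ∃ u ∈ K, ∃ c, Below G f c u ∧ f c < M := by
  by_contra! hcon
  refine hXinf ((finite_setOf_dist_le hK hball fun u => f u - M).subset fun v hv => ?_)
  obtain ⟨u, hu, he⟩ := hX v hv
  have := hcon u hu v (by unfold Below; linarith)
  exact ⟨u, hu, by linarith⟩

lemma finite_setOf_abs_le (hcov : X ∪ Y ∪ K = Set.univ) (hK : K.Finite)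
    (hball : ∀ (x : V) (R : ℝ), {y | (G.dist x y : ℝ) ≤ R}.Finite) {f : V → ℝ}
    (hX : ∀ v ∈ X, ∃ u ∈ K, f v = f u - G.dist v u)
    (hY : ∀ v ∈ Y, ∃ u ∈ K, f v = f u + G.dist v u) (R : ℝ) : {v | |f v| ≤ R}.Finite := by
  refine (finite_setOf_dist_le hK hball fun u => |f u| + R).subset fun v hv => ?_
  obtain ⟨h1, h2⟩ := abs_le.1 (show |f v| ≤ R from hv)
  rcases (hcov.symm ▸ Set.mem_univ v : v ∈ X ∪ Y ∪ K) with (hv | hv) | hv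
  · obtain ⟨u, hu, he⟩ := hX v hv
    exact ⟨u, hu, by linarith [le_abs_self (f u)]⟩
  · obtain ⟨u, hu, he⟩ := hY v hv
    exact ⟨u, hu, by linarith [neg_abs_le (f u)]⟩
  · refine ⟨v, hv, ?_⟩
    have : 0 ≤ |f v| := abs_nonneg _
    simpa using by linarith

end Partition

section Flux

variable {w : V → V → ℝ}

open Classical in
/-- The flux of `∇f` through the level `r`, restricted to edges inside `B`. -/
noncomputable def levelFlux (w : V → V → ℝ) (f : V → ℝ) (B : Finset V) (r : ℝ) : ℝ :=
  ∑ v ∈ B, ∑ u ∈ B, if f u < r ∧ r ≤ f v then w v u * (f v - f u) else 0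

open Classical in
lemma levelFlux_eq_sum (hsymm : ∀ x y, w x y = w y x) (f : V → ℝ) (B : Finset V) (r : ℝ) :
    levelFlux w f B r =
      ∑ v ∈ B, if r ≤ f v then ∑ u ∈ B, w v u * (f v - f u) else 0 := by
  have hanti : ∑ v ∈ B, ∑ u ∈ B,
      (if r ≤ f u ∧ r ≤ f v then w v u * (f v - f u) else 0) = 0 := by
    have h : ∑ v ∈ B, ∑ u ∈ B, (if r ≤ f u ∧ r ≤ f v then w v u * (f v - f u) else 0) =
        -∑ v ∈ B, ∑ u ∈ B, (if r ≤ f u ∧ r ≤ f v then w v u * (f v - f u) else 0) := by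
      conv_lhs => rw [Finset.sum_comm]
      rw [← Finset.sum_neg_distrib]
      refine Finset.sum_congr rfl fun v _ => ?_
      rw [← Finset.sum_neg_distrib]
      refine Finset.sum_congr rfl fun u _ => ?_
      rw [hsymm u v]
      by_cases hu : r ≤ f u <;> by_cases hv : r ≤ f v <;> simp only [hu, hv, and_true, and_false,
        if_true, if_false, neg_zero]
      ring
    linarith
  refine ((add_zero _).symm.trans (congrArg _ hanti.symm)).trans ?_
  rw [levelFlux, ← Finset.sum_add_distrib]
  refine Finset.sum_congr rfl fun v _ => ?_
  rw [← Finset.sum_add_distrib]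
  by_cases hv : r ≤ f v
  · rw [if_pos hv]
    refine Finset.sum_congr rfl fun u _ => ?_
    rcases lt_or_ge (f u) r with hu | hu
    · simp [hu, hv, hu.not_ge]
    · simp [hu, hv, hu.not_gt]
  · simp [hv]

variable {m f : V → ℝ}

lemma sum_eq_zero_of_lap_eq_zero (hnn : ∀ x y, 0 ≤ w x y) (hm : ∀ x, 0 < m x)
    (hLF : LocallyFinite w)
    {v : V} (hharm : lap w m f v = 0) {B : Finset V} (hB : ∀ u, 0 < w v u → u ∈ B) :
    ∑ u ∈ B, w v u * (f v - f u) = 0 := by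
  rw [lap_eq_sum hnn hLF] at hharm
  have h := (mul_eq_zero.1 hharm).resolve_left (inv_pos.2 (hm v)).ne'
  have hsub : (hLF v).toFinset ⊆ B := fun u hu => hB u (by simpa using hu)
  rw [Finset.sum_subset hsub] at h
  · rw [← neg_eq_zero, ← h, ← Finset.sum_neg_distrib]
    exact Finset.sum_congr rfl fun u _ => by ring
  · intro u _ hu
    have : w v u = 0 := le_antisymm (by simpa using hu) (hnn v u)
    rw [this, zero_mul]

lemma levelFlux_eq_levelFlux (hsymm : ∀ x y, w x y = w y x) (hnn : ∀ x y, 0 ≤ w x y)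
    (hm : ∀ x, 0 < m x) (hLF : LocallyFinite w) (hf : ∀ x y, 0 < w x y → |f x - f y| ≤ 1)
    (hharm : ∀ x, lap w m f x = 0) {R : ℝ} {B : Finset V} (hB : ∀ v, v ∈ B ↔ |f v| ≤ R) {r s : ℝ}
    (hr : |r| + 1 ≤ R) (hs : |s| + 1 ≤ R) :
    levelFlux w f B r = levelFlux w f B s := by
  classical
  rw [levelFlux_eq_sum hsymm, levelFlux_eq_sum hsymm]
  refine Finset.sum_congr rfl fun v _ => ?_
  obtain ⟨hr1, hr2⟩ := abs_le.1 (le_sub_iff_add_le.2 hr)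
  obtain ⟨hs1, hs2⟩ := abs_le.1 (le_sub_iff_add_le.2 hs)
  have hzero : |f v| ≤ R - 1 → ∑ u ∈ B, w v u * (f v - f u) = 0 := by
    intro hv
    refine sum_eq_zero_of_lap_eq_zero hnn hm hLF (hharm v) fun u hu => (hB u).2 ?_
    have h1 := abs_sub_abs_le_abs_sub (f u) (f v)
    have h2 := hf v u hu
    rw [abs_sub_comm] at h2
    linarith
  split_ifs with h1 h2 h2
  · rfl
  · push Not at h2
    exact hzero (abs_le.2 ⟨by linarith, by linarith⟩)
  · push Not at h1
    exact (hzero (abs_le.2 ⟨by linarith, by linarith⟩)).symm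
  · rfl

lemma cutSum_eq_levelFlux (hnn : ∀ x y, 0 ≤ w x y) (hf : ∀ x y, 0 < w x y → |f x - f y| ≤ 1)
    {R : ℝ} {B : Finset V} (hB : ∀ v, v ∈ B ↔ |f v| ≤ R) (hR : 1 ≤ R) :
    cutSum w f = levelFlux w f B 0 := by
  classical
  rw [levelFlux, ← Finset.sum_product', cutSum, finsum_eq_sum_of_support_subset]
  intro p hp
  simp only [Function.mem_support, ne_eq, ite_eq_right_iff, Classical.not_imp] at hp
  obtain ⟨⟨h2, h1⟩, hne⟩ := hp
  have hw := lt_of_le_of_ne (hnn p.1 p.2) (left_ne_zero_of_mul hne).symm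
  have h3 := (abs_le.1 (hf _ _ hw)).2
  rw [Finset.mem_coe, Finset.mem_product, hB, hB]
  exact ⟨abs_le.2 ⟨by linarith, by linarith⟩, abs_le.2 ⟨by linarith, by linarith⟩⟩

lemma card_mul_le_levelFlux (hnn : ∀ x y, 0 ≤ w x y) {ε : ℝ} (hw : ∀ x y, 0 < w x y → ε ≤ w x y)
    {B S : Finset V} {r : ℝ} (hSB : S ⊆ B) (hS : ∀ v ∈ S, f v < r)
    (hstep : ∀ v ∈ S, ∃ u ∈ B, 0 < w u v ∧ f u = f v + 1 ∧ r ≤ f u) :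
    S.card * ε ≤ levelFlux w f B r := by
  classical
  have hterm : ∀ u v, 0 ≤ if f u < r ∧ r ≤ f v then w v u * (f v - f u) else 0 := by
    intro u v
    split_ifs with h
    · exact mul_nonneg (hnn v u) (by linarith [h.1, h.2])
    · exact le_rfl
  rw [levelFlux, Finset.sum_comm, ← nsmul_eq_mul]
  refine (Finset.card_nsmul_le_sum S _ ε fun v hv => ?_).trans
    (Finset.sum_le_sum_of_subset_of_nonneg hSB fun u _ _ => Finset.sum_nonneg fun v _ => hterm u v)
  obtain ⟨u, hu, hwu, hfu, hru⟩ := hstep v hv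
  refine le_trans ?_ (Finset.single_le_sum (fun z _ => hterm v z) hu)
  rw [if_pos ⟨hS v hv, hru⟩, hfu]
  simpa using hw u v hwu

end Flux

section Slab

variable {G : SimpleGraph V} {w : V → V → ℝ} {m f : V → ℝ}

lemma card_slab_le (hG : G.Connected) (hadj : ∀ x y, G.Adj x y ↔ 0 < w x y)
    (hsymm : ∀ x y, w x y = w y x) (hnn : ∀ x y, 0 ≤ w x y) (hm : ∀ x, 0 < m x)
    (hLF : LocallyFinite w) {ε : ℝ} (hε : 0 < ε) (hw : ∀ x y, 0 < w x y → ε ≤ w x y)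
    (hf : ∀ x y, f y - f x ≤ G.dist x y) (hharm : ∀ x, lap w m f x = 0)
    (hfin : ∀ R : ℝ, {v | |f v| ≤ R}.Finite) (hup : ∀ v M, ∃ c, Below G f v c ∧ M < f c)
    (r : ℝ) :
    ∃ S : Finset V, (∀ v, v ∈ S ↔ v ∈ slab f r) ∧ (S.card : ℝ) ≤ cutSum w f / ε := by
  have hf1 : ∀ x y, 0 < w x y → |f x - f y| ≤ 1 := by
    intro x y hxy
    have h1 := hf x y
    have h2 := hf y x
    rw [G.dist_comm] at h2
    rw [SimpleGraph.dist_eq_one_iff_adj.2 ((hadj x y).2 hxy), Nat.cast_one] at h1 h2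
    exact abs_le.2 ⟨by linarith, h2⟩
  set R : ℝ := |r| + 2 with hR
  have hr := abs_le.1 (le_refl |r|)
  have hB : ∀ v, v ∈ (hfin R).toFinset ↔ |f v| ≤ R := fun v => by simp
  have hsub : slab f r ⊆ {v | |f v| ≤ R} := fun v hv =>
    show |f v| ≤ R from abs_le.2 ⟨by linarith [hv.1, hr.1], by linarith [hv.2, hr.2]⟩
  refine ⟨((hfin R).subset hsub).toFinset, fun v => by simp, ?_⟩
  rw [le_div_iff₀ hε, cutSum_eq_levelFlux hnn hf1 hB (by linarith [abs_nonneg r]),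
    levelFlux_eq_levelFlux hsymm hnn hm hLF hf1 hharm hB (r := 0) (s := r + 1)
      (by rw [abs_zero]; linarith [abs_nonneg r])
      (by linarith [abs_add_le r 1, abs_one (α := ℝ)])]
  refine card_mul_le_levelFlux hnn hw (fun v hv => ?_) (fun v hv => ?_) fun v hv => ?_
  · exact (hB v).2 (hsub (by simpa using hv))
  · exact ((Set.Finite.mem_toFinset _).1 hv).2
  · have hv' : v ∈ slab f r := (Set.Finite.mem_toFinset _).1 hv
    obtain ⟨c, hc, hd⟩ := exists_above_dist_eq hG hf hup v 1
    unfold Below at hc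
    rw [hd, Nat.cast_one] at hc
    refine ⟨c, (hB c).2 (abs_le.2 ⟨by linarith [hv'.1, hr.1], by linarith [hv'.2, hr.2]⟩), ?_,
      by linarith, by linarith [hv'.1]⟩
    rw [hsymm]
    exact (hadj v c).1 (SimpleGraph.dist_eq_one_iff_adj.1 hd)

lemma dist_le_of_slab_card_le (hG : G.Connected) (hf : ∀ x y, f y - f x ≤ G.dist x y)
    (hlift : LiftsUp G f) (hlift' : LiftsUp G (-f))
    (hup : ∀ v M, ∃ c, Below G f v c ∧ M < f c) (hdown : ∀ v M, ∃ c, Below G f c v ∧ f c < M)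
    {N : ℝ} (hcard : ∀ r, ∃ S : Finset V, (∀ v, v ∈ S ↔ v ∈ slab f r) ∧ (S.card : ℝ) ≤ N)
    {a b : V} (hab : f a ≤ f b) : (G.dist a b : ℝ) ≤ f b - f a + 2 * N := by
  obtain ⟨c, hac, hd⟩ := exists_above_dist_eq hG hf hup a ⌊f b - f a⌋₊
  have h1 := Nat.floor_le (sub_nonneg.2 hab)
  have h2 := Nat.lt_floor_add_one (f b - f a)
  rw [← hd] at h1 h2
  have h3 := hac
  unfold Below at h3
  obtain ⟨S, hS, hN⟩ := hcard (f c)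
  have hc : c ∈ slab f (f c) := ⟨le_rfl, by linarith⟩
  have hb : b ∈ slab f (f c) := ⟨by linarith, by linarith⟩
  have h4 : (G.dist c b : ℝ) ≤ 2 * S.card := by
    exact_mod_cast dist_le_of_slabStep_reflTransGen hG hS ((hS c).2 hc)
      (slabStep_reflTransGen hG hf hlift hlift' hup hdown hc hb)
  linarith [cast_dist_triangle hG a c b]

end Slab

/-- **Theorem (Quasi-isometry to the line).** For a salami with combinatorial
distance and edge weights bounded below by `ε`, every `f ∈ ℋ(P)` is a
quasi-isometric embedding into `ℝ`:
`|f(x)-f(y)| ≤ d₀(x,y) ≤ |f(x)-f(y)| + C` with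
`C = (2/ε) ∑_{f(y)<0≤f(x)} w(x,y)(f(x)-f(y))`. -/
theorem salami_quasi_isometry {V : Type*} (w : V → V → ℝ) (m : V → ℝ)
    (hS : IsSalami w m (combDist w)) (X Y K : Set V)
    (hP : ConnectedSalamiPartition w m X Y K)
    (ε : ℝ) (hε : 0 < ε) (hw : ∀ x y, 0 < w x y → ε ≤ w x y)
    (f : V → ℝ) (hf : f ∈ calH w m (combDist w) X Y K) (x y : V) :
    |f x - f y| ≤ combDist w x y ∧
    combDist w x y ≤ |f x - f y| + (2 / ε) * cutSum w f := by
  obtain ⟨⟨-, hsymm, hnn, hdiag, hm, hLF, hconn, -, hball⟩, hcurv, -⟩ := hS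
  obtain ⟨⟨hcov, hXY, hXK, hYK, hK, hsep, hXvol, hYvol⟩, -⟩ := hP
  obtain ⟨hfF, hharm⟩ := hf
  have : Nonempty V := ⟨x⟩
  have hG := adjGraph_connected hsymm hdiag hconn
  have hdist : combDist w = fun a b => ((adjGraph w hsymm hdiag).dist a b : ℝ) := by
    ext a b
    exact combDist_eq_dist hsymm hdiag hG a b
  have hadj : ∀ a b, (adjGraph w hsymm hdiag).Adj a b ↔ 0 < w a b := fun _ _ => Iff.rfl
  rw [hdist] at hball hcurv hfF ⊢
  generalize adjGraph w hsymm hdiag = G at *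
  have hd1 : ∀ a b, 0 < w a b → (G.dist a b : ℝ) = 1 ∧ (G.dist b a : ℝ) = 1 := by
    intro a b hab
    have h : G.dist a b = 1 := SimpleGraph.dist_eq_one_iff_adj.2 ((hadj a b).2 hab)
    rw [G.dist_comm (u := b), h]
    simp
  have hXinf := hXvol.infinite hm
  have hYinf := hYvol.infinite hm
  have hcross : ∀ a ∈ X, ∀ b ∈ Y, ∃ u ∈ K, G.dist a u + G.dist u b = G.dist a b :=
    fun a ha b hb => exists_mem_separator hG hadj hcov hXY hsep ha hb
  have hKne : K.Nonempty := by
    obtain ⟨a, ha⟩ := hXinf.nonempty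
    obtain ⟨b, hb⟩ := hYinf.nonempty
    obtain ⟨u, hu, -⟩ := hcross a ha b hb
    exact ⟨u, hu⟩
  obtain ⟨hKK, hX, hY⟩ := calF_spec hXY hXK hYK hK hKne hfF
  have hLip := extension_lipschitz hG hcov hcross hKK hX hY
  have hLip' : ∀ a b, (-f) b - (-f) a ≤ G.dist a b := by
    intro a b
    have := hLip b a
    rw [G.dist_comm] at this
    simp only [Pi.neg_apply]
    linarith
  have hedge : ∀ g : V → ℝ, (∀ a b, g b - g a ≤ G.dist a b) → ∀ a b, G.Adj a b →
      g b - g a = 1 → lap w m g b ≤ lap w m g a :=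
    fun g hg a b hab => lap_le_lap_of_adj hnn hm hLF hd1 hcurv hg ((hadj a b).1 hab)
  have hlift := liftsUp_of_lap_eq_zero hG hadj hnn hm hLF hedge hLip hharm
  have hlift' := liftsUp_of_lap_eq_zero hG hadj hnn hm hLF hedge hLip'
    (fun a => by rw [lap_neg, hharm, neg_zero])
  have hlow := exists_below_lt_of_infinite hK hball hXinf fun v hv => (hX v hv).1
  have hhigh := exists_below_lt_of_infinite (f := -f) hK hball hYinf fun v hv => by
    obtain ⟨u, hu, he⟩ := (hY v hv).1
    exact ⟨u, hu, by simp only [Pi.neg_apply]; linarith⟩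
  have hup : ∀ v M, ∃ c, Below G f v c ∧ M < f c := by
    refine hlift.exists_above_gt hG hLip hK fun M => ?_
    obtain ⟨u, hu, c, hc, hlt⟩ := hhigh (-M)
    exact ⟨u, hu, c, below_neg.1 hc, by simpa using hlt⟩
  have hdown : ∀ v M, ∃ c, Below G f c v ∧ f c < M := by
    intro v M
    obtain ⟨c, hc, hlt⟩ := hlift'.exists_above_gt hG hLip' hK (fun M => by
      obtain ⟨u, hu, c, hc, hlt⟩ := hlow (-M)
      exact ⟨u, hu, c, below_neg.2 hc, by simp only [Pi.neg_apply]; linarith⟩) v (-M)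
    exact ⟨c, below_neg.1 hc, by simpa using hlt⟩
  have hfin := finite_setOf_abs_le hcov hK hball (fun v hv => (hX v hv).1) fun v hv => (hY v hv).1
  have hcard := card_slab_le hG hadj hsymm hnn hm hLF hε hw hLip hharm hfin hup
  refine ⟨abs_le.2 ⟨?_, ?_⟩, ?_⟩
  · have := hLip x y
    linarith
  · have := hLip y x
    rw [G.dist_comm] at this
    exact this
  · have hmain := fun a b => dist_le_of_slab_card_le hG hLip hlift hlift' hup hdown hcard
      (a := a) (b := b)
    rcases le_total (f x) (f y) with h | h
    · have := hmain x y h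
      rw [abs_sub_comm, abs_of_nonneg (sub_nonneg.2 h), div_mul_eq_mul_div, mul_div_assoc]
      exact this
    · have := hmain y x h
      rw [G.dist_comm] at this
      rw [abs_of_nonneg (sub_nonneg.2 h), div_mul_eq_mul_div, mul_div_assoc]
      exact this

end SalamiPaper
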